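/- For all integers n ≥ 0 and 0 ≤ j ≤ n+1, one has the polynomial identity F_q(n,0,j) = [n]_q · [n−1]_q ⋯ [j]_q (the empty product for j = n+1 being 1). -/

import Mathlib

open Polynomial

/-- The `q`-integer `[m]_q = 1 + q + ⋯ + q^{m-1}` as a polynomial in `q` over `ℤ`. -/
noncomputable def qIntP (m : ℕ) : Polynomial ℤ :=
  ∑ i ∈ Finset.range m, Polynomial.X ^ i

/-- Auxiliary descending recursion: `Faux n k d = F_q(n, k, n-k+1-d)`. -/
noncomputable def Faux (n k : ℕ) : ℕ → Polynomial ℤ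
  | 0 => 1
  | 1 => qIntP k + qIntP (n - k)
  | (d + 2) =>
      (qIntP (n - k - 1 - d) + qIntP (n - (n - k - 1 - d))) * Faux n k (d + 1) -
        Polynomial.X ^ k * qIntP ((n - k - 1 - d) + 1 - k) *
          qIntP (n - k - (n - k - 1 - d)) * Faux n k d

/-- The polynomial `F_q(n, k, j)` of the paper, defined for `k ≤ j ≤ n-k+1` by:
`F_q(n,k,n-k+1) = 1`, `F_q(n,k,n-k) = [k]_q + [n-k]_q`, and for `k ≤ j < n-k`,
`F_q(n,k,j) = ([j]_q + [n-j]_q)·F_q(n,k,j+1) - q^k·[j+1-k]_q·[n-k-j]_q·F_q(n,k,j+2)`. -/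
noncomputable def FP (n k j : ℕ) : Polynomial ℤ :=
  Faux n k (n - k + 1 - j)

theorem Faux_zero_succ (n d : ℕ) (h : d ≤ n) :
    Faux n 0 (d + 1) = qIntP (n - d) * Faux n 0 d := by
  induction d with
  | zero => simp [Faux, qIntP]
  | succ d ih =>
    obtain ⟨m, rfl⟩ := Nat.exists_eq_add_of_le' h
    have ih := ih (by omega)
    rw [show m + (d + 1) - d = m + 1 by omega] at ih
    rw [Faux, ih]
    simp only [show m + (d + 1) - 1 - d = m by omega,
      show m + (d + 1) - (d + 1) = m by omega, Nat.sub_zero]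
    ring

theorem FP_zero_eq_prod (n j : ℕ) (h : j ≤ n + 1) :
    FP n 0 j = ∏ t ∈ Finset.Icc j n, qIntP t := by
  obtain ⟨d, hd⟩ := Nat.exists_eq_add_of_le h
  rw [FP, show n - 0 + 1 - j = d by omega]
  induction d generalizing j with
  | zero =>
    rw [Finset.Icc_eq_empty (by omega), Finset.prod_empty, Faux]
  | succ d ih =>
    rw [Faux_zero_succ n d (by omega), ih (j + 1) (by omega) (by omega),
      show n - d = j by omega, Finset.Icc_add_one_left_eq_Ioc,
      Finset.mul_prod_Ioc_eq_prod_Icc (by omega)]
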